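/- arXiv:math/0005273 — 3 statements merged into one kernel-verified Lean document; each statement's English description precedes it below -/
import Mathlib

section
/- Let X be an infinite set and let I ⊆ P(X) be a maximal ideal containing all finite subsets of X, and let C_I := ⋃_{n≥1} { f ∈ O^(n)(X) : for every A ∈ I, f[A^n] ∈ I }. Then I = { A ⊆ X : every unary function f : X → X with ran(f) ⊆ A belongs to C_I }. In particular, the map I ↦ C_I from maximal ideals containing all finite sets to clones is injective. -/
open Cardinal Set

universe u v

abbrev Operation (X : Type u) : Type u := Σ n : ℕ, ((Fin (n + 1) → X) → X)

def IsClone {X : Type u} (C : Set (Operation X)) : Prop :=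
  (∀ (n : ℕ) (k : Fin (n + 1)), (⟨n, fun x => x k⟩ : Operation X) ∈ C) ∧
  (∀ (n m : ℕ) (g : (Fin (m + 1) → X) → X) (f : Fin (m + 1) → (Fin (n + 1) → X) → X),
    (⟨m, g⟩ : Operation X) ∈ C → (∀ i, (⟨n, f i⟩ : Operation X) ∈ C) →
    (⟨n, fun x => g fun i => f i x⟩ : Operation X) ∈ C)

def unaryOp {X : Type u} (f : X → X) : Operation X := ⟨0, fun x => f (x 0)⟩

def binOp {X : Type u} (g : X → X → X) : Operation X := ⟨1, fun x => g (x 0) (x 1)⟩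

def PrecompleteClone {X : Type u} (C : Set (Operation X)) : Prop :=
  IsClone C ∧ C ≠ Set.univ ∧
    ∀ D : Set (Operation X), IsClone D → C ⊆ D → D = C ∨ D = Set.univ

def cloneGen {X : Type u} (F : Set (Operation X)) : Set (Operation X) :=
  ⋂₀ {C : Set (Operation X) | IsClone C ∧ F ⊆ C}

def cl {X : Type u} (F : Set (Operation X)) : Set (Operation X) :=
  ⋂₀ {C : Set (Operation X) | IsClone C ∧ F ⊆ C ∧ ∀ f : X → X, unaryOp f ∈ C}

def Pol {X : Type u} {I : Type v} (R : Set (I → X)) : Set (Operation X) :=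
  {op | ∀ ρ : Fin (op.1 + 1) → (I → X), (∀ j, ρ j ∈ R) →
    (fun i => op.2 fun j => ρ j i) ∈ R}

def IsPairing {X : Type u} (f : X → X → X) : Prop :=
  ∀ ⦃x y x' y' : X⦄, x ≠ y → x' ≠ y' → f x y = f x' y' → x = x' ∧ y = y'

def almostUnary2 {X : Type u} (g : X × X → X) : Prop :=
  ∃ G : X → Set X, (∀ x : X, #↥(G x) < #X) ∧
    ((∀ p : X × X, g p ∈ G p.1) ∨ (∀ p : X × X, g p ∈ G p.2))

def AU2 (X : Type u) : Set (X × X → X) := {g | almostUnary2 g}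

def HeavilyBinary {X : Type u} (C : Set (Operation X)) : Prop :=
  ∃ H : X → X → X, binOp H ∈ C ∧
    (∃ b : X, #↥(Set.range fun x => H x b) = #X) ∧
    (∃ a : X, #↥(Set.range fun y => H a y) = #X)

def IsCanonicalOn {X : Type u} [LinearOrder X] (F : X → X → X) (S : Set X) : Prop :=
  ∀ a b : Fin 4 → X, (∀ i, a i ∈ S) → (∀ i, b i ∈ S) →
    (∀ i j, a i < a j ↔ b i < b j) → a 0 ≠ a 1 → a 2 ≠ a 3 →
    (F (a 0) (a 1) < F (a 2) (a 3) → F (b 0) (b 1) < F (b 2) (b 3))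

def PrColoring {X : Type u} {M : Type v} [LinearOrder X] (c : X → X → M) : Prop :=
  (∀ x y : X, c x y = c y x) ∧
  ∀ a : X → Finset X, (∀ i j : X, i ≠ j → Disjoint (a i) (a j)) →
    ∀ c₀ : M, ∃ i j : X, i < j ∧ ∀ x ∈ a i, ∀ y ∈ a j, c x y = c₀

open Classical in
noncomputable def FA {X : Type u} {M : Type v} [LinearOrder X]
    (c : X → X → M) (pr : X → X → X) (z : X) (A : Set M) (α β : X) : X :=
  if α = z ∨ β = z ∨ α = β then max α β
  else if c α β ∈ A then pr α β else z

def opImageOn {X : Type u} (op : Operation X) (A : Set X) : Set X :=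
  op.2 '' {x : Fin (op.1 + 1) → X | ∀ i, x i ∈ A}

def CIdeal {X : Type u} (I : Set (Set X)) : Set (Operation X) :=
  {op | ∀ A ∈ I, opImageOn op A ∈ I}

theorem opImageOn_unaryOp {X : Type u} (f : X → X) (A : Set X) :
    opImageOn (unaryOp f) A = f '' A := by
  ext y
  constructor
  · rintro ⟨x, hx, rfl⟩
    exact ⟨x 0, hx 0, rfl⟩
  · rintro ⟨a, ha, rfl⟩
    exact ⟨fun _ => a, fun _ => ha, rfl⟩

theorem exists_injective_range_mem {X : Type u} [Infinite X] (I : Set (Set X))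
    (hdown : ∀ A B : Set X, A ⊆ B → B ∈ I → A ∈ I)
    (hmax : ∀ A : Set X, A ∈ I ∨ Aᶜ ∈ I) :
    ∃ j : X → X, Function.Injective j ∧ Set.range j ∈ I := by
  have hcard : #(X ⊕ X) = #X := by
    simp [Cardinal.add_eq_self (Cardinal.aleph0_le_mk X)]
  obtain ⟨e⟩ := Cardinal.eq.1 hcard
  rcases hmax (Set.range (e ∘ Sum.inl)) with h | h
  · exact ⟨_, e.injective.comp Sum.inl_injective, h⟩
  · refine ⟨_, e.injective.comp Sum.inr_injective, hdown _ _ ?_ h⟩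
    rintro _ ⟨x, rfl⟩ ⟨y, hy⟩
    exact Sum.inl_ne_inr (e.injective hy)

theorem eq_setOf_unaryOp_mem_CIdeal {X : Type u} [Infinite X] (I : Set (Set X))
    (hdown : ∀ A B : Set X, A ⊆ B → B ∈ I → A ∈ I)
    (hmax : ∀ A : Set X, A ∈ I ∨ Aᶜ ∈ I)
    (hfin : ∀ A : Set X, A.Finite → A ∈ I) :
    I = {A : Set X | ∀ f : X → X, Set.range f ⊆ A → unaryOp f ∈ CIdeal I} := by
  classical
  ext A
  constructor
  · intro hA f hf B _
    rw [opImageOn_unaryOp]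
    exact hdown _ _ ((Set.image_subset_range f B).trans hf) hA
  · intro h
    rcases A.eq_empty_or_nonempty with rfl | ⟨a, ha⟩
    · exact hfin _ Set.finite_empty
    obtain ⟨j, hj, hjI⟩ := exists_injective_range_mem I hdown hmax
    let g : X → X := fun x => if x ∈ A then x else a
    have hg : ∀ x, g x ∈ A := fun x => by
      by_cases hx : x ∈ A <;> simp [g, hx, ha]
    have hf : Set.range (Function.extend j g fun _ => a) ⊆ A := by
      rintro _ ⟨y, rfl⟩
      by_cases hy : ∃ x, j x = y
      · obtain ⟨x, rfl⟩ := hy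
        rw [hj.extend_apply]
        exact hg x
      · rwa [Function.extend_apply' _ _ _ hy]
    have himage := h _ hf _ hjI
    rw [opImageOn_unaryOp] at himage
    refine hdown _ _ (fun x hx => ?_) himage
    exact ⟨j x, ⟨x, rfl⟩, by simp [hj.extend_apply, g, hx]⟩

theorem stmt3 {X : Type u} [Infinite X] (I : Set (Set X))
    (hdown : ∀ A B : Set X, A ⊆ B → B ∈ I → A ∈ I)
    (hunion : ∀ A B : Set X, A ∈ I → B ∈ I → A ∪ B ∈ I)
    (hproper : Set.univ ∉ I)
    (hmax : ∀ A : Set X, A ∈ I ∨ Aᶜ ∈ I)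
    (hfin : ∀ A : Set X, A.Finite → A ∈ I) :
    I = {A : Set X | ∀ f : X → X, Set.range f ⊆ A → unaryOp f ∈ CIdeal I} ∧
    ∀ J : Set (Set X),
      (∀ A B : Set X, A ⊆ B → B ∈ J → A ∈ J) →
      (∀ A B : Set X, A ∈ J → B ∈ J → A ∪ B ∈ J) →
      Set.univ ∉ J →
      (∀ A : Set X, A ∈ J ∨ Aᶜ ∈ J) →
      (∀ A : Set X, A.Finite → A ∈ J) →
      CIdeal I = CIdeal J → I = J := by
  refine ⟨eq_setOf_unaryOp_mem_CIdeal I hdown hmax hfin, ?_⟩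
  intro J hJdown _ _ hJmax hJfin hIJ
  rw [eq_setOf_unaryOp_mem_CIdeal I hdown hmax hfin, hIJ,
    ← eq_setOf_unaryOp_mem_CIdeal J hJdown hJmax hJfin]
end

section
/- Let λ be a regular infinite cardinal, let c : λ × λ → μ be a symmetric function witnessing Pr(λ,μ), let pr : λ × λ → λ be a pairing function with 0 ∉ ran(pr), and for A ⊆ μ let F_A be defined from c and pr as in the context. If A, B ⊆ μ satisfy A ∪ B = μ, then cl({F_A, F_B}) = O(λ); indeed the function pr'(α,β) := F_A(F_A(α,β), F_B(α,β)) agrees with pr(α,β) for all distinct α, β > 0, hence is a pairing function. -/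
open Cardinal Set

universe u v

theorem exists_disjoint_injections_avoiding {X : Type u} [Infinite X] (z : X) :
    ∃ i j : X → X, Function.Injective i ∧ Function.Injective j ∧
      (∀ a, i a ≠ z) ∧ (∀ a, j a ≠ z) ∧ ∀ a b, i a ≠ j b := by
  classical
  have hcard : #(Option (X ⊕ X)) = #X := by
    have h := aleph0_le_mk X
    rw [mk_option, mk_sum, lift_id, add_eq_self h, add_one_eq h]
  obtain ⟨e₀⟩ := Cardinal.eq.1 hcard
  let e : Option (X ⊕ X) ≃ X := e₀.trans (Equiv.swap (e₀ none) z)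
  have he : e none = z := by simp [e]
  refine ⟨fun a => e (some (.inl a)), fun a => e (some (.inr a)), ?_, ?_, ?_, ?_, ?_⟩
  · intro a b h
    simpa using h
  · intro a b h
    simpa using h
  · intro a h
    simpa using e.injective (h.trans he.symm)
  · intro a h
    simpa using e.injective (h.trans he.symm)
  · intro a b h
    simpa using e.injective h

namespace IsClone

variable {X : Type u} {C : Set (Operation X)}

theorem unary_comp (hC : IsClone C) {f : X → X} (hf : unaryOp f ∈ C) {n : ℕ}
    {g : (Fin (n + 1) → X) → X} (hg : (⟨n, g⟩ : Operation X) ∈ C) :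
    (⟨n, fun x => f (g x)⟩ : Operation X) ∈ C :=
  hC.2 n 0 (fun x => f (x 0)) (fun _ => g) hf fun _ => hg

theorem binary_comp (hC : IsClone C) {h : X → X → X} (hh : binOp h ∈ C) {n : ℕ}
    {f g : (Fin (n + 1) → X) → X} (hf : (⟨n, f⟩ : Operation X) ∈ C)
    (hg : (⟨n, g⟩ : Operation X) ∈ C) :
    (⟨n, fun x => h (f x) (g x)⟩ : Operation X) ∈ C :=
  hC.2 n 1 (fun x => h (x 0) (x 1)) ![f, g] hh (Fin.forall_fin_two.2 ⟨hf, hg⟩)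

theorem exists_injective_mem (hC : IsClone C) {h : X → X → X} (hh : binOp h ∈ C)
    (hinj : Function.Injective2 h) (n : ℕ) :
    ∃ J : (Fin (n + 1) → X) → X, Function.Injective J ∧ (⟨n, J⟩ : Operation X) ∈ C := by
  induction n with
  | zero =>
    refine ⟨fun x => x 0, fun x y hxy => ?_, hC.1 0 0⟩
    funext i
    rwa [Fin.fin_one_eq_zero i]
  | succ n ih =>
    obtain ⟨J, hJ, hJC⟩ := ih
    refine ⟨fun x => h (J fun i => x i.castSucc) (x (Fin.last _)), fun x y hxy => ?_,
      hC.binary_comp hh (hC.2 _ _ J _ hJC fun i => hC.1 _ i.castSucc) (hC.1 _ _)⟩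
    obtain ⟨h₁, h₂⟩ := hinj hxy
    funext i
    exact Fin.lastCases h₂ (fun i => congrFun (hJ h₁) i) i

theorem eq_univ_of_injective2 [Nonempty X] (hC : IsClone C) (hun : ∀ f : X → X, unaryOp f ∈ C)
    {h : X → X → X} (hh : binOp h ∈ C) (hinj : Function.Injective2 h) : C = Set.univ := by
  refine Set.eq_univ_of_forall fun ⟨n, f⟩ => ?_
  obtain ⟨J, hJ, hJC⟩ := hC.exists_injective_mem hh hinj n
  have hf := hC.unary_comp (hun fun y => f (Function.invFun J y)) hJC
  simpa only [Function.leftInverse_invFun hJ _] using hf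

/-- A clone containing all unary operations and a binary operation that agrees, off the diagonal
and away from a point `z`, with a pairing function is the full clone. -/
theorem eq_univ_of_pairing [Infinite X] (hC : IsClone C) (hun : ∀ f : X → X, unaryOp f ∈ C)
    {p pr : X → X → X} (hp : binOp p ∈ C) (hpr : IsPairing pr) (z : X)
    (heq : ∀ α β, α ≠ z → β ≠ z → α ≠ β → p α β = pr α β) : C = Set.univ := by
  obtain ⟨i, j, hi, hj, hiz, hjz, hij⟩ := exists_disjoint_injections_avoiding z
  refine hC.eq_univ_of_injective2 hun (h := fun a b => p (i a) (j b))
    (hC.binary_comp hp (hC.unary_comp (hun i) (hC.1 1 0))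
      (hC.unary_comp (hun j) (hC.1 1 1))) fun a a' b b' h => ?_
  beta_reduce at h
  rw [heq _ _ (hiz _) (hjz _) (hij _ _), heq _ _ (hiz _) (hjz _) (hij _ _)] at h
  exact (hpr (hij _ _) (hij _ _) h).imp (@hi _ _) (@hj _ _)

end IsClone

theorem FA_comp_eq_pairing {X : Type u} {M : Type v} [LinearOrder X]
    (c : X → X → M) (pr : X → X → X) {z : X} (hz : ∀ x : X, z ≤ x)
    {A B : Set M} (hAB : A ∪ B = Set.univ) {α β : X} (hα : α ≠ z) (hβ : β ≠ z) (h : α ≠ β) :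
    FA c pr z A (FA c pr z A α β) (FA c pr z B α β) = pr α β := by
  have hmem : c α β ∈ A ∨ c α β ∈ B := Set.eq_univ_iff_forall.1 hAB (c α β)
  by_cases hA : c α β ∈ A <;> by_cases hB : c α β ∈ B <;>
    simp_all [FA]

theorem stmt13 {X M : Type u} [LinearOrder X] [WellFoundedLT X]
    (hreg : (#X).IsRegular)
    (hsmall : ∀ x : X, #{y : X | y < x} < #X)
    (c : X → X → M) (hc : PrColoring c)
    (pr : X → X → X) (hpr : IsPairing pr)
    (z : X) (hz : ∀ x : X, z ≤ x)
    (hzran : z ∉ Set.range fun p : X × X => pr p.1 p.2)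
    (A B : Set M) (hAB : A ∪ B = Set.univ) :
    (∀ α β : X, z < α → z < β → α ≠ β →
      FA c pr z A (FA c pr z A α β) (FA c pr z B α β) = pr α β) ∧
    cl {binOp (FA c pr z A), binOp (FA c pr z B)} = Set.univ := by
  have hpair : ∀ α β : X, α ≠ z → β ≠ z → α ≠ β →
      FA c pr z A (FA c pr z A α β) (FA c pr z B α β) = pr α β :=
    fun α β hα hβ h => FA_comp_eq_pairing c pr hz hAB hα hβ h
  refine ⟨fun α β hα hβ h => hpair α β hα.ne' hβ.ne' h, ?_⟩
  have : Infinite X := Cardinal.infinite_iff.2 hreg.aleph0_le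
  refine Set.eq_univ_of_forall fun op => Set.mem_sInter.2 fun C ⟨hC, hF, hun⟩ => ?_
  have hA : binOp (FA c pr z A) ∈ C := hF (by simp)
  have hB : binOp (FA c pr z B) ∈ C := hF (by simp)
  have huniv := hC.eq_univ_of_pairing hun
    (p := fun α β => FA c pr z A (FA c pr z A α β) (FA c pr z B α β))
    (hC.binary_comp hA hA hB) hpr z hpair
  exact huniv ▸ Set.mem_univ op
end

section
/- Let λ be an infinite cardinal satisfying λ → (λ)^2_2 (i.e., λ = ℵ_0 or λ is weakly compact). Then there is exactly one precomplete clone C on λ such that C contains all unary functions and C contains a binary function depending heavily on both of its coordinates. Equivalently, whenever C_1 and C_2 are heavily binary clones on λ, each containing all unary functions, and the smallest clone containing C_1 ∪ C_2 is O(λ), then C_1 = O(λ) or C_2 = O(λ). -/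
open Cardinal Set

universe u v

/-! ### Combinatorics of a well-order with the partition property -/

/-- Injectivity of a binary function above the diagonal. -/
def InjAbove {X : Type u} [LinearOrder X] (f : X → X → X) : Prop :=
  ∀ ⦃x₁ y₁ x₂ y₂ : X⦄, x₁ < y₁ → x₂ < y₂ → f x₁ y₁ = f x₂ y₂ → x₁ = x₂ ∧ y₁ = y₂

/-- Every subset of smaller cardinality is strictly bounded. -/
def SmallBounded (X : Type u) [LinearOrder X] : Prop :=
  ∀ S : Set X, #S < #X → ∃ b, ∀ s ∈ S, s < b

/-- The partition property, phrased with strictly monotone reindexings. -/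
def Homogenizes (X : Type u) [LinearOrder X] : Prop :=
  ∀ P : X → X → Prop, ∃ e : X → X, StrictMono e ∧
    ((∀ x y, x < y → P (e x) (e y)) ∨ (∀ x y, x < y → ¬ P (e x) (e y)))

theorem smallBounded_of_partition {X : Type u} [LinearOrder X] [Infinite X]
    (hsmall : ∀ x : X, #{y : X | y < x} < #X)
    (hpart : ∀ f : X → X → Bool, ∃ A : Set X, #↥A = #X ∧ ∃ b : Bool,
      ∀ x ∈ A, ∀ y ∈ A, x < y → f x y = b) : SmallBounded X := by
  classical
  intro S hS
  by_contra! hcof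
  choose s hsS hs using hcof
  obtain ⟨A, hA, b, hb⟩ := hpart fun x y => decide (s x = s y)
  have hle : ∀ z : X, #(Set.Iic z) < #X := by
    intro z
    have : Set.Iic z = insert z {y : X | y < z} := by
      ext y; simp [le_iff_eq_or_lt]
    rw [this]
    refine (Cardinal.mk_insert_le).trans_lt ?_
    exact Cardinal.add_lt_of_lt (Cardinal.aleph0_le_mk X) (hsmall z)
      (Cardinal.one_lt_aleph0.trans_le (Cardinal.aleph0_le_mk X))
  cases b with
  | true =>
    have hne : A.Nonempty := by
      rw [← Set.nonempty_coe_sort, ← Cardinal.mk_ne_zero_iff, hA]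
      exact Cardinal.mk_ne_zero X
    obtain ⟨a, ha⟩ := hne
    have hsub : A ⊆ Set.Iic (s a) := by
      intro x hx
      rcases lt_trichotomy x a with h | h | h
      · have := hb x hx a ha h
        simp only [decide_eq_true_eq] at this
        exact this ▸ hs x
      · exact h ▸ hs x
      · have := hb a ha x hx h
        simp only [decide_eq_true_eq] at this
        exact this ▸ hs x
    exact absurd ((Cardinal.mk_le_mk_of_subset hsub).trans_lt (hle _)) (by simp [hA])
  | false =>
    have hinj : Function.Injective fun x : A => (⟨s x, hsS x⟩ : S) := by
      rintro ⟨x, hx⟩ ⟨y, hy⟩ hxy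
      simp only [Subtype.mk.injEq] at hxy ⊢
      rcases lt_trichotomy x y with h | h | h
      · have := hb x hx y hy h
        simp [hxy] at this
      · exact h
      · have := hb y hy x hx h
        simp [hxy] at this
    exact absurd ((Cardinal.mk_le_of_injective hinj).trans_lt hS) (by simp [hA])

/-- Recursive construction of a reindexing whose next value only has to avoid few obstructions. -/
theorem exists_recursive_selection {X : Type u} [LinearOrder X] [WellFoundedLT X]
    (hsmall : ∀ x : X, #{y : X | y < x} < #X) (good : Set X → X → Prop)
    (h : ∀ S : Set X, #S < #X → ∃ w, good S w) :
    ∃ e : X → X, ∀ x, good (e '' {y | y < x}) (e x) := by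
  classical
  let step : (x : X) → ((y : X) → y < x → X) → X := fun x r =>
    if hw : ∃ w, good {w | ∃ y, ∃ hy : y < x, r y hy = w} w then hw.choose else x
  let e : X → X := (wellFounded_lt (α := X)).fix step
  refine ⟨e, fun x => ?_⟩
  have he : e x = step x fun y _ => e y := (wellFounded_lt (α := X)).fix_eq step x
  have hset : {w | ∃ y, ∃ _ : y < x, e y = w} = e '' {y | y < x} := by
    ext w; simp
  have hw : ∃ w, good {w | ∃ y, ∃ _ : y < x, e y = w} w := by
    rw [hset]
    exact h _ (Cardinal.mk_image_le.trans_lt (hsmall x))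
  rw [he, ← hset]
  simp only [step, dif_pos hw]
  exact hw.choose_spec

theorem homogenizes_of_partition {X : Type u} [LinearOrder X] [WellFoundedLT X]
    (hsmall : ∀ x : X, #{y : X | y < x} < #X) (hreg : SmallBounded X)
    (hpart : ∀ f : X → X → Bool, ∃ A : Set X, #↥A = #X ∧ ∃ b : Bool,
      ∀ x ∈ A, ∀ y ∈ A, x < y → f x y = b) : Homogenizes X := by
  classical
  intro P
  obtain ⟨A, hA, b, hb⟩ := hpart fun x y => decide (P x y)
  obtain ⟨e, he⟩ := exists_recursive_selection hsmall
    (fun S w => w ∈ A ∧ ∀ s ∈ S, s < w) (by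
      intro S hS
      obtain ⟨b, hb⟩ := hreg S hS
      by_contra! hcon
      have hsub : A ⊆ {y | y < b} := by
        intro w hw
        obtain ⟨s, hs, hws⟩ := hcon w hw
        exact hws.trans_lt (hb s hs)
      exact absurd ((Cardinal.mk_le_mk_of_subset hsub).trans_lt (hsmall b)) (by simp [hA]))
  refine ⟨e, fun x y hxy => (he y).2 _ ⟨x, hxy, rfl⟩, ?_⟩
  have key : ∀ x y, x < y → decide (P (e x) (e y)) = b := fun x y hxy =>
    hb _ (he x).1 _ (he y).1 ((he y).2 _ ⟨x, hxy, rfl⟩)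
  cases b with
  | true => exact Or.inl fun x y hxy => by simpa using key x y hxy
  | false => exact Or.inr fun x y hxy => by simpa using key x y hxy

theorem SmallBounded.noMaxOrder {X : Type u} [LinearOrder X] [Infinite X]
    (hreg : SmallBounded X) : NoMaxOrder X := by
  refine ⟨fun a => ?_⟩
  obtain ⟨b, hb⟩ := hreg {a} (by
    rw [Cardinal.mk_singleton]
    exact Cardinal.one_lt_aleph0.trans_le (Cardinal.aleph0_le_mk X))
  exact ⟨b, hb a rfl⟩

theorem SmallBounded.eventually_forall {X : Type u} [LinearOrder X] [Infinite X]
    (hreg : SmallBounded X) {S : Set X} (hS : #S < #X) {P : X → X → Prop}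
    (h : ∀ s ∈ S, ∀ᶠ y in Filter.atTop, P s y) : ∀ᶠ y in Filter.atTop, ∀ s ∈ S, P s y := by
  have h' : ∀ s, ∃ b, s ∈ S → ∀ y ≥ b, P s y := by
    intro s
    by_cases hs : s ∈ S
    · obtain ⟨b, hb⟩ := Filter.eventually_atTop.1 (h s hs)
      exact ⟨b, fun _ => hb⟩
    · exact ⟨s, fun hs' => absurd hs' hs⟩
  choose b hb using h'
  obtain ⟨c, hc⟩ := hreg (b '' S) (Cardinal.mk_image_le.trans_lt hS)
  exact Filter.eventually_atTop.2
    ⟨c, fun y hy s hs => hb s hs y ((hc _ ⟨s, hs, rfl⟩).le.trans hy)⟩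

theorem tendsto_atTop_of_strictMono {X : Type u} [LinearOrder X] [WellFoundedLT X]
    {e : X → X} (he : StrictMono e) : Filter.Tendsto e Filter.atTop Filter.atTop :=
  Filter.tendsto_atTop_mono (fun _ => he.le_apply) Filter.tendsto_id

/-- Along a suitable reindexing, each of `#X` many predicates is eventually decided. -/
theorem exists_eventually_decided {X : Type u} [LinearOrder X] [WellFoundedLT X] [Infinite X]
    (hsmall : ∀ x : X, #{y : X | y < x} < #X) (hreg : SmallBounded X) (hhom : Homogenizes X)
    (P : X → X → Prop) :
    ∃ e : X → X, StrictMono e ∧ ∀ i, (∀ᶠ y in Filter.atTop, P i (e y)) ∨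
      (∀ᶠ y in Filter.atTop, ¬ P i (e y)) := by
  have := hreg.noMaxOrder
  obtain ⟨e, he, hcase⟩ := hhom fun y y' =>
    ∃ i, (∀ j < i, (P j y ↔ P j y')) ∧ ¬ P i y ∧ P i y'
  refine ⟨e, he, fun i => ?_⟩
  induction i using WellFoundedLT.induction with
  | ind i ih =>
  have hstab : ∀ j ∈ {j | j < i}, ∃ c : Prop, ∀ᶠ y in Filter.atTop, (P j (e y) ↔ c) := by
    intro j hj
    rcases ih j hj with h | h
    · exact ⟨True, h.mono fun y hy => by simp [hy]⟩
    · exact ⟨False, h.mono fun y hy => by simp [hy]⟩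
  have hstab' : ∀ j, ∃ c : Prop, j ∈ {j | j < i} → ∀ᶠ y in Filter.atTop, (P j (e y) ↔ c) := by
    intro j
    by_cases hj : j ∈ {j | j < i}
    · obtain ⟨c, hc⟩ := hstab j hj
      exact ⟨c, fun _ => hc⟩
    · exact ⟨True, fun h => absurd h hj⟩
  choose c hc using hstab'
  obtain ⟨b, hb⟩ := Filter.eventually_atTop.1 (hreg.eventually_forall (hsmall i) hc)
  have hagree : ∀ y ≥ b, ∀ y' ≥ b, ∀ j < i, (P j (e y) ↔ P j (e y')) := fun y hy y' hy' j hj =>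
    (hb y hy j hj).trans (hb y' hy' j hj).symm
  rcases hcase with h | h
  · have hmono : ∀ y ≥ b, ∀ y' > y, P i (e y) → P i (e y') := by
      intro y hy y' hyy' hP
      obtain ⟨k, hk, hk1, hk2⟩ := h y y' hyy'
      rcases lt_trichotomy k i with hki | rfl | hki
      · exact absurd ((hagree y hy y' (hy.le.trans hyy'.le) k hki).2 hk2) hk1
      · exact absurd hP hk1
      · exact (hk i hki).1 hP
    by_cases hex : ∃ y ≥ b, P i (e y)
    · obtain ⟨y, hy, hP⟩ := hex
      exact Or.inl ((Filter.eventually_gt_atTop y).mono fun y' hy' => hmono y hy y' hy' hP)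
    · push Not at hex
      exact Or.inr ((Filter.eventually_ge_atTop b).mono hex)
  · have hanti : ∀ y ≥ b, ∀ y' > y, P i (e y') → P i (e y) := by
      intro y hy y' hyy' hP
      by_contra hn
      exact h y y' hyy' ⟨i, hagree y hy y' (hy.le.trans hyy'.le), hn, hP⟩
    by_cases hex : ∃ y ≥ b, ¬ P i (e y)
    · obtain ⟨y, hy, hP⟩ := hex
      exact Or.inr ((Filter.eventually_gt_atTop y).mono fun y' hy' hP' =>
        hP (hanti y hy y' hy' hP'))
    · push Not at hex
      exact Or.inl ((Filter.eventually_ge_atTop b).mono hex)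

theorem exists_eventually_decided₂ {X : Type u} [LinearOrder X] [WellFoundedLT X] [Infinite X]
    (hsmall : ∀ x : X, #{y : X | y < x} < #X) (hreg : SmallBounded X) (hhom : Homogenizes X)
    (P : X → X → X → Prop) :
    ∃ e : X → X, StrictMono e ∧ ∀ i j, (∀ᶠ y in Filter.atTop, P i j (e y)) ∨
      (∀ᶠ y in Filter.atTop, ¬ P i j (e y)) := by
  have hX : #(X × X) = #X := by
    rw [← Cardinal.mul_def, Cardinal.mul_eq_self (Cardinal.aleph0_le_mk X)]
  obtain ⟨φ⟩ := Cardinal.eq.1 hX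
  obtain ⟨e, he, h⟩ := exists_eventually_decided hsmall hreg hhom
    fun k => P (φ.symm k).1 (φ.symm k).2
  exact ⟨e, he, fun i j => by simpa using h (φ (i, j))⟩

/-- Canonical form of a binary function above the diagonal. -/
theorem exists_canonical {X : Type u} [LinearOrder X] [WellFoundedLT X] [Infinite X]
    (hsmall : ∀ x : X, #{y : X | y < x} < #X) (hreg : SmallBounded X) (hhom : Homogenizes X)
    (g : X → X → X) :
    ∃ e : X → X, StrictMono e ∧
      ((∃ h : X → X, ∀ x y, x < y → g (e x) (e y) = h x) ∨
       (∃ h : X → X, ∀ x y, x < y → g (e x) (e y) = h y) ∨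
       InjAbove fun x y => g (e x) (e y)) := by
  have := hreg.noMaxOrder
  obtain ⟨e₁, he₁, hd₁⟩ := exists_eventually_decided₂ hsmall hreg hhom fun x m y => g x y = m
  obtain ⟨e₂, he₂, hd₂⟩ := exists_eventually_decided₂ hsmall hreg hhom
    fun x x' y => g x (e₁ y) = g x' (e₁ y)
  obtain ⟨e₃, he₃, hU⟩ := hhom
    fun x _ => ∃ m, ∀ᶠ y in Filter.atTop, g (e₁ (e₂ x)) (e₁ (e₂ y)) = m
  obtain ⟨e₄, he₄, hV⟩ := hhom fun x x' =>
    ∀ᶠ y in Filter.atTop, g (e₁ (e₂ (e₃ x))) (e₁ (e₂ y)) = g (e₁ (e₂ (e₃ x'))) (e₁ (e₂ y))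
  set d : X → X := fun x => e₁ (e₂ (e₃ (e₄ x)))
  have hd : StrictMono d := he₁.comp (he₂.comp (he₃.comp he₄))
  have t₂ := tendsto_atTop_of_strictMono he₂
  have t₃₄ := tendsto_atTop_of_strictMono (he₃.comp he₄)
  by_cases hconst : ∀ x, ∃ m, ∀ᶠ y in Filter.atTop, g (d x) (d y) = m
  · choose m hm using hconst
    obtain ⟨e, he⟩ := exists_recursive_selection hsmall
      (fun S w => ∀ s ∈ S, s < w ∧ g (d s) (d w) = m s) fun S hS =>
        (hreg.eventually_forall hS fun s _ =>
          (Filter.eventually_gt_atTop s).and (hm s)).exists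
    refine ⟨d ∘ e, hd.comp fun x y hxy => (he y _ ⟨x, hxy, rfl⟩).1, Or.inl ⟨m ∘ e, ?_⟩⟩
    exact fun x y hxy => (he y _ ⟨x, hxy, rfl⟩).2
  have hinf : ∀ x m, ∀ᶠ y in Filter.atTop, g (d x) (d y) ≠ m := by
    intro x m
    rcases hU with hU | hU
    · refine absurd (fun x => ?_) hconst
      obtain ⟨x', hx'⟩ := exists_gt (e₄ x)
      obtain ⟨m, hm⟩ := hU _ _ hx'
      exact ⟨m, t₃₄.eventually hm⟩
    · rcases hd₁ (d x) m with h | h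
      · obtain ⟨x', hx'⟩ := exists_gt (e₄ x)
        exact absurd ⟨m, t₂.eventually h⟩ (hU _ _ hx')
      · exact (t₂.comp t₃₄).eventually h
  rcases hV with hV | hV
  · have heq : ∀ x x', ∀ᶠ y in Filter.atTop, g (d x) (d y) = g (d x') (d y) := by
      intro x x'
      rcases lt_trichotomy x x' with h | rfl | h
      · exact t₃₄.eventually (hV _ _ h)
      · simp
      · exact (t₃₄.eventually (hV _ _ h)).mono fun y hy => hy.symm
    obtain ⟨e, he⟩ := exists_recursive_selection hsmall
      (fun S w => ∀ s ∈ S, s < w ∧ ∀ s' ∈ S, g (d s) (d w) = g (d s') (d w)) fun S hS =>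
        (hreg.eventually_forall hS fun s _ => (Filter.eventually_gt_atTop s).and
          (hreg.eventually_forall hS fun s' _ => heq s s')).exists
    refine ⟨d ∘ e, hd.comp fun x y hxy => (he y _ ⟨x, hxy, rfl⟩).1, Or.inr (Or.inl ?_)⟩
    obtain ⟨z, -, hz⟩ := (wellFounded_lt (α := X)).has_min Set.univ Set.univ_nonempty
    refine ⟨fun y => g (d (e z)) (d (e y)), fun x y hxy => ?_⟩
    have hzx : z ≤ x := not_lt.1 (hz x trivial)
    exact (he y _ ⟨x, hxy, rfl⟩).2 _ ⟨z, hzx.trans_lt hxy, rfl⟩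
  · have hne : ∀ x x', x ≠ x' → ∀ᶠ y in Filter.atTop, g (d x) (d y) ≠ g (d x') (d y) := by
      have : ∀ x x', x < x' → ∀ᶠ y in Filter.atTop, g (d x) (d y) ≠ g (d x') (d y) := by
        intro x x' h
        rcases hd₂ (d x) (d x') with h' | h'
        · exact absurd h' (hV _ _ h)
        · exact t₃₄.eventually h'
      intro x x' hxx'
      rcases lt_or_gt_of_ne hxx' with h | h
      · exact this x x' h
      · exact (this x' x h).mono fun y hy => hy.symm
    obtain ⟨e, he⟩ := exists_recursive_selection hsmall
      (fun S w => ∀ s ∈ S, s < w ∧ ∀ s' ∈ S, (s ≠ s' → g (d s) (d w) ≠ g (d s') (d w)) ∧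
        ∀ t ∈ S, g (d s) (d w) ≠ g (d s') (d t)) fun S hS =>
        (hreg.eventually_forall hS fun s _ => (Filter.eventually_gt_atTop s).and
          (hreg.eventually_forall hS fun s' _ => Filter.Eventually.and
            (by
              by_cases hss' : s = s'
              · simp [hss']
              · simpa [hss'] using hne s s' hss')
            (hreg.eventually_forall hS fun t _ => hinf s _))).exists
    have hmono : StrictMono e := fun x y hxy => (he y _ ⟨x, hxy, rfl⟩).1
    refine ⟨d ∘ e, hd.comp hmono, Or.inr (Or.inr ?_)⟩
    intro x y x' y' hxy hxy' heq
    have hyy' : y = y' := by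
      rcases lt_trichotomy y y' with h | h | h
      · exact absurd heq.symm (((he y' _ ⟨x', hxy', rfl⟩).2 _ ⟨x, hxy.trans h, rfl⟩).2 _ ⟨y, h, rfl⟩)
      · exact h
      · exact absurd heq (((he y _ ⟨x, hxy, rfl⟩).2 _ ⟨x', hxy'.trans h, rfl⟩).2 _ ⟨y', h, rfl⟩)
    subst hyy'
    refine ⟨?_, rfl⟩
    by_contra hxx'
    exact ((he y _ ⟨x, hxy, rfl⟩).2 _ ⟨x', hxy', rfl⟩).1
      (fun h => hxx' (hmono.injective h)) heq

theorem InjAbove.comp_strictMono {X : Type u} [LinearOrder X] {f : X → X → X}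
    (hf : InjAbove f) {e : X → X} (he : StrictMono e) : InjAbove fun x y => f (e x) (e y) := by
  intro x y x' y' hxy hxy' h
  obtain ⟨h1, h2⟩ := hf (he hxy) (he hxy') h
  exact ⟨he.injective h1, he.injective h2⟩

theorem InjAbove.eventually_ne {X : Type u} [LinearOrder X] [NoMaxOrder X] [Nonempty X]
    {f : X → X → X} (hf : InjAbove f) (s m : X) : ∀ᶠ w in Filter.atTop, f s w ≠ m := by
  by_cases h : ∃ w > s, f s w = m
  · obtain ⟨w, hw, rfl⟩ := h
    exact (Filter.eventually_gt_atTop w).mono fun y hy heq =>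
      hy.ne' (hf (hw.lt.trans hy) hw heq).2
  · push Not at h
    exact (Filter.eventually_gt_atTop s).mono h

/-- A function injective above the diagonal can be made to avoid the range of a unary function. -/
theorem InjAbove.exists_avoiding {X : Type u} [LinearOrder X] [WellFoundedLT X] [Infinite X]
    (hsmall : ∀ x : X, #{y : X | y < x} < #X) (hreg : SmallBounded X) (hhom : Homogenizes X)
    {f : X → X → X} (hf : InjAbove f) (h : X → X) :
    ∃ e : X → X, StrictMono e ∧ ∀ x y z, x < y → f (e x) (e y) ≠ h (e z) := by
  have := hreg.noMaxOrder
  obtain ⟨e₁, he₁, h₁⟩ := hhom fun x y => f x y = h y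
  obtain ⟨e₂, he₂, h₂⟩ := hhom fun x y => h (e₁ x) = h (e₁ y)
  set d : X → X := fun x => e₁ (e₂ x)
  have hd : StrictMono d := he₁.comp he₂
  have hdiag : ∀ x y, x < y → f (d x) (d y) ≠ h (d y) := by
    rcases h₁ with h₁ | h₁
    · obtain ⟨a⟩ : Nonempty X := inferInstance
      obtain ⟨b, hab⟩ := exists_gt a
      obtain ⟨c, hbc⟩ := exists_gt b
      have := (hf (he₁ (hab.trans hbc)) (he₁ hbc)
        ((h₁ a c (hab.trans hbc)).trans (h₁ b c hbc).symm)).1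
      exact absurd (he₁.injective this) hab.ne
    · exact fun x y hxy => h₁ _ _ (he₂ hxy)
  rcases h₂ with h₂ | h₂
  · refine ⟨d, hd, fun x y z hxy => ?_⟩
    have : h (d z) = h (d y) := by
      rcases lt_trichotomy z y with hzy | rfl | hzy
      · exact h₂ _ _ hzy
      · rfl
      · exact (h₂ _ _ hzy).symm
    rw [this]
    exact hdiag x y hxy
  · have hev : ∀ m, ∀ᶠ w in Filter.atTop, m ≠ h (d w) := by
      intro m
      by_cases hex : ∃ w, m = h (d w)
      · obtain ⟨w, rfl⟩ := hex
        exact (Filter.eventually_gt_atTop w).mono fun y hy => h₂ _ _ hy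
      · push Not at hex
        exact Filter.Eventually.of_forall hex
    have hfd := hf.comp_strictMono hd
    obtain ⟨e, he⟩ := exists_recursive_selection hsmall
      (fun S w => ∀ s ∈ S, s < w ∧ ∀ s' ∈ S,
        f (d s) (d w) ≠ h (d s') ∧ f (d s) (d s') ≠ h (d w)) fun S hS =>
        (hreg.eventually_forall hS fun s _ => (Filter.eventually_gt_atTop s).and
          (hreg.eventually_forall hS fun s' _ =>
            (hfd.eventually_ne s _).and (hev _))).exists
    have hmono : StrictMono e := fun x y hxy => (he y _ ⟨x, hxy, rfl⟩).1
    refine ⟨d ∘ e, hd.comp hmono, fun x y z hxy => ?_⟩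
    rcases lt_trichotomy z y with hzy | rfl | hzy
    · exact ((he y _ ⟨x, hxy, rfl⟩).2 _ ⟨z, hzy, rfl⟩).1
    · exact hdiag _ _ (hmono hxy)
    · exact ((he z _ ⟨x, hxy.trans hzy, rfl⟩).2 _ ⟨y, hzy, rfl⟩).2

/-! ### Clones containing all unary functions -/

theorem IsClone.unary_comp_s16 {X : Type u} {C : Set (Operation X)} (hC : IsClone C)
    (hun : ∀ f : X → X, unaryOp f ∈ C) {n : ℕ} {f : (Fin (n + 1) → X) → X}
    (hf : (⟨n, f⟩ : Operation X) ∈ C) (u : X → X) :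
    (⟨n, fun x => u (f x)⟩ : Operation X) ∈ C :=
  hC.2 n 0 (fun x => u (x 0)) (fun _ => f) (hun u) fun _ => hf

theorem IsClone.binary_comp_s16 {X : Type u} {C : Set (Operation X)} (hC : IsClone C)
    {F : X → X → X} (hF : binOp F ∈ C) {n : ℕ} {f g : (Fin (n + 1) → X) → X}
    (hf : (⟨n, f⟩ : Operation X) ∈ C) (hg : (⟨n, g⟩ : Operation X) ∈ C) :
    (⟨n, fun x => F (f x) (g x)⟩ : Operation X) ∈ C :=
  hC.2 n 1 (fun x => F (x 0) (x 1)) ![f, g] hF fun i => by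
    fin_cases i
    · exact hf
    · exact hg

theorem IsClone.binOp_comp_unary {X : Type u} {C : Set (Operation X)} (hC : IsClone C)
    (hun : ∀ f : X → X, unaryOp f ∈ C) {F : X → X → X} (hF : binOp F ∈ C) (α β : X → X) :
    binOp (fun x y => F (α x) (β y)) ∈ C :=
  hC.binary_comp_s16 hF (hC.unary_comp_s16 hun (hC.1 1 0) α) (hC.unary_comp_s16 hun (hC.1 1 1) β)

theorem IsClone.eq_univ_of_injective {X : Type u} [Nonempty X] {C : Set (Operation X)}
    (hC : IsClone C) (hun : ∀ f : X → X, unaryOp f ∈ C) {J : X → X → X} (hJ : binOp J ∈ C)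
    (hinj : ∀ x y x' y', J x y = J x' y' → x = x' ∧ y = y') : C = Set.univ := by
  have key : ∀ n : ℕ, ∃ f : (Fin (n + 1) → X) → X,
      (⟨n, f⟩ : Operation X) ∈ C ∧ Function.Injective f := by
    intro n
    induction n with
    | zero =>
      refine ⟨fun x => x 0, hC.1 0 0, fun x y hxy => ?_⟩
      ext i
      rw [Fin.fin_one_eq_zero i]
      exact hxy
    | succ n ih =>
      obtain ⟨f, hf, hfi⟩ := ih
      refine ⟨fun x => J (x 0) (f fun i => x i.succ), hC.binary_comp_s16 hJ (hC.1 _ 0)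
        (hC.2 _ n f (fun i x => x i.succ) hf fun i => hC.1 _ _), fun x y hxy => ?_⟩
      obtain ⟨h0, h1⟩ := hinj _ _ _ _ hxy
      funext i
      refine Fin.cases h0 (fun i => congrFun (hfi h1) i) i
  refine Set.eq_univ_of_forall ?_
  rintro ⟨n, g⟩
  obtain ⟨f, hf, hfi⟩ := key n
  have hg : g = fun x => (g ∘ Function.invFun f) (f x) :=
    funext fun x => (congrArg g (Function.leftInverse_invFun hfi x)).symm
  rw [hg]
  exact hC.unary_comp_s16 hun hf (g ∘ Function.invFun f)

theorem IsClone.eq_univ_of_injAbove_of_injAbove_swap {X : Type u} [LinearOrder X]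
    [WellFoundedLT X] [Infinite X] (hsmall : ∀ x : X, #{y : X | y < x} < #X)
    (hreg : SmallBounded X) {C : Set (Operation X)} (hC : IsClone C)
    (hun : ∀ f : X → X, unaryOp f ∈ C) {F : X → X → X} (hF : binOp F ∈ C)
    (h₁ : InjAbove F) (h₂ : InjAbove fun x y => F y x) : C = Set.univ := by
  have := hreg.noMaxOrder
  obtain ⟨e, he⟩ := exists_recursive_selection hsmall
    (fun S w => ∀ s ∈ S, s < w ∧ ∀ t ∈ S, ∀ t' ∈ S, F s w ≠ F t t' ∧ F w s ≠ F t t')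
    fun S hS => (hreg.eventually_forall hS fun s _ => (Filter.eventually_gt_atTop s).and
      (hreg.eventually_forall hS fun t _ => hreg.eventually_forall hS fun t' _ =>
        (h₁.eventually_ne s _).and (h₂.eventually_ne s _))).exists
  have hmono : StrictMono e := fun x y hxy => (he y _ ⟨x, hxy, rfl⟩).1
  have hmax : ∀ x y x' y', x < y → y' < x' → F (e x) (e y) = F (e x') (e y') → y = x' := by
    intro x y x' y' hxy hxy' heq
    rcases lt_trichotomy y x' with h | h | h
    · exact absurd heq.symm (((he x' _ ⟨y', hxy', rfl⟩).2 _ ⟨x, hxy.trans h, rfl⟩ _ ⟨y, h, rfl⟩).2)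
    · exact h
    · exact absurd heq (((he y _ ⟨x, hxy, rfl⟩).2 _ ⟨x', h, rfl⟩ _ ⟨y', hxy'.trans h, rfl⟩).1)
  have hX : #(X ⊕ X) = #X := by
    rw [← Cardinal.add_def, Cardinal.add_eq_self (Cardinal.aleph0_le_mk X)]
  obtain ⟨φ⟩ := Cardinal.eq.1 hX
  have hdisj : ∀ x y, φ (Sum.inl x) ≠ φ (Sum.inr y) := fun x y h => by
    simpa using φ.injective h
  refine hC.eq_univ_of_injective hun
    (hC.binOp_comp_unary hun hF (fun x => e (φ (Sum.inl x))) fun y => e (φ (Sum.inr y))) ?_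
  intro x y x' y' heq
  have fin : φ (Sum.inl x) = φ (Sum.inl x') → φ (Sum.inr y) = φ (Sum.inr y') →
      x = x' ∧ y = y' := fun hx hy => ⟨by simpa using hx, by simpa using hy⟩
  rcases lt_or_gt_of_ne (hdisj x y) with h | h <;>
    rcases lt_or_gt_of_ne (hdisj x' y') with h' | h'
  · obtain ⟨a, b⟩ := h₁.comp_strictMono hmono h h' heq
    exact fin a b
  · exact absurd (hmax _ _ _ _ h h' heq).symm (hdisj _ _)
  · exact absurd (hmax _ _ _ _ h' h heq.symm).symm (hdisj _ _)
  · obtain ⟨b, a⟩ := h₂.comp_strictMono hmono h h' heq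
    exact fin a b

theorem exists_injective_comp_of_mk_range {X : Type u} {f : X → X}
    (hf : #(Set.range f) = #X) : ∃ α : X → X, Function.Injective fun x => f (α x) := by
  obtain ⟨φ⟩ := Cardinal.eq.1 hf
  choose α hα using fun x => (φ.symm x).2
  refine ⟨α, fun x y hxy => ?_⟩
  simp only [hα] at hxy
  exact φ.symm.injective (Subtype.ext hxy)

theorem IsClone.eq_univ_of_injAbove {X : Type u} [LinearOrder X] [WellFoundedLT X] [Infinite X]
    (hsmall : ∀ x : X, #{y : X | y < x} < #X) (hreg : SmallBounded X) (hhom : Homogenizes X)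
    {C : Set (Operation X)} (hC : IsClone C) (hun : ∀ f : X → X, unaryOp f ∈ C)
    (hH : HeavilyBinary C) {F : X → X → X} (hF : binOp F ∈ C) (hinj : InjAbove F) :
    C = Set.univ := by
  classical
  obtain ⟨e, he, hcase⟩ := exists_canonical hsmall hreg hhom fun x y => F y x
  have hinj' := hinj.comp_strictMono he
  have hF' := hC.binOp_comp_unary hun hF e e
  by_cases hswap : InjAbove fun x y => F (e y) (e x)
  · exact hC.eq_univ_of_injAbove_of_injAbove_swap hsmall hreg hun hF' hinj' hswap
  obtain ⟨h, hh⟩ : ∃ h : X → X, ∀ x y, x < y →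
      F (e y) (e x) = h x ∨ F (e y) (e x) = h y := by
    rcases hcase with ⟨h, hh⟩ | ⟨h, hh⟩ | hh
    · exact ⟨h, fun x y hxy => Or.inl (hh x y hxy)⟩
    · exact ⟨h, fun x y hxy => Or.inr (hh x y hxy)⟩
    · exact absurd hh hswap
  obtain ⟨d, hd, havoid⟩ := hinj'.exists_avoiding hsmall hreg hhom h
  set G : X → X → X := fun x y => F (e (d x)) (e (d y))
  have hG : binOp G ∈ C := hC.binOp_comp_unary hun hF' d d
  have hGinj : InjAbove G := hinj'.comp_strictMono hd
  set R : Set X := Set.range fun z => h (d z)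
  have hup : ∀ x y, x < y → G x y ∉ R := by
    rintro x y hxy ⟨z, hz⟩
    exact havoid x y z hxy hz.symm
  have hdown : ∀ x y, x < y → G y x ∈ R := by
    intro x y hxy
    rcases hh _ _ (hd hxy) with h' | h'
    · exact ⟨x, h'.symm⟩
    · exact ⟨y, h'.symm⟩
  obtain ⟨H, hHC, ⟨b, hb⟩, ⟨a, ha⟩⟩ := hH
  obtain ⟨α, hα⟩ := exists_injective_comp_of_mk_range hb
  obtain ⟨β, hβ⟩ := exists_injective_comp_of_mk_range ha
  have hGswap : (⟨1, fun x => G (x 1) (x 0)⟩ : Operation X) ∈ C :=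
    hC.binary_comp_s16 hG (hC.1 1 1) (hC.1 1 0)
  have hN : binOp (fun x y => H (if G x y ∈ R then a else α (G x y))
      (if G y x ∈ R then b else β (G y x))) ∈ C :=
    hC.binary_comp_s16 hHC (hC.unary_comp_s16 hun hG fun v => if v ∈ R then a else α v)
      (hC.unary_comp_s16 hun hGswap fun v => if v ∈ R then b else β v)
  refine hC.eq_univ_of_injAbove_of_injAbove_swap hsmall hreg hun hN ?_ ?_
  · intro x y x' y' hxy hxy' heq
    simp only [hup _ _ hxy, hup _ _ hxy', hdown _ _ hxy, hdown _ _ hxy', if_true, if_false] at heq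
    exact hGinj hxy hxy' (hα heq)
  · intro x y x' y' hxy hxy' heq
    simp only [hup _ _ hxy, hup _ _ hxy', hdown _ _ hxy, hdown _ _ hxy', if_true, if_false] at heq
    exact hGinj hxy hxy' (hβ heq)

/-! ### The largest proper heavily binary clone -/

/-- Binary functions that are not injective above the diagonal of any large set. -/
def NowhereInjAbove {X : Type u} [LinearOrder X] (g : X → X → X) : Prop :=
  ∀ e : X → X, StrictMono e → ¬ InjAbove fun x y => g (e x) (e y)

/-- The polymorphisms of the set of functions satisfying `NowhereInjAbove`. -/
def nowhereInjClone (X : Type u) [LinearOrder X] : Set (Operation X) :=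
  {op | ∀ g : Fin (op.1 + 1) → X → X → X, (∀ i, NowhereInjAbove (g i)) →
    NowhereInjAbove fun x y => op.2 fun i => g i x y}

theorem isClone_nowhereInjClone (X : Type u) [LinearOrder X] : IsClone (nowhereInjClone X) :=
  ⟨fun _ k _ hg => hg k, fun _ _ _ _ hg hf ρ hρ => hg _ fun i => hf i ρ hρ⟩

theorem unaryOp_mem_nowhereInjClone {X : Type u} [LinearOrder X] (f : X → X) :
    unaryOp f ∈ nowhereInjClone X := by
  intro g hg e he hinj
  exact hg 0 e he fun x y x' y' hxy hxy' h => hinj hxy hxy' (congrArg f h)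

theorem nowhereInjClone_ne_univ {X : Type u} [LinearOrder X] [Infinite X] [NoMaxOrder X] :
    nowhereInjClone X ≠ Set.univ := by
  intro huniv
  have hX : #(X × X) = #X := by
    rw [← Cardinal.mul_def, Cardinal.mul_eq_self (Cardinal.aleph0_le_mk X)]
  obtain ⟨φ⟩ := Cardinal.eq.1 hX
  have hmem : binOp (fun x y => φ (x, y)) ∈ nowhereInjClone X := huniv ▸ Set.mem_univ _
  obtain ⟨a⟩ : Nonempty X := inferInstance
  obtain ⟨b, hab⟩ := exists_gt a
  obtain ⟨c, hbc⟩ := exists_gt b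
  refine hmem ![fun x _ => x, fun _ y => y] (fun i => ?_) id strictMono_id ?_
  · fin_cases i
    · exact fun e he hinj => hbc.ne (hinj hab (hab.trans hbc) rfl).2
    · exact fun e he hinj => hab.ne (hinj (hab.trans hbc) hbc rfl).1
  · intro x y x' y' _ _ h
    exact Prod.mk.inj (φ.injective h)

theorem heavilyBinary_nowhereInjClone {X : Type u} [LinearOrder X] [WellFoundedLT X]
    [Nonempty X] (hhom : Homogenizes X) : HeavilyBinary (nowhereInjClone X) := by
  obtain ⟨z, -, hz⟩ := (wellFounded_lt (α := X)).has_min Set.univ Set.univ_nonempty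
  have hz' : ∀ x, z ≤ x := fun x => not_lt.1 (hz x trivial)
  refine ⟨max, ?_, ⟨z, ?_⟩, ⟨z, ?_⟩⟩
  · intro g hg e he hinj
    obtain ⟨d, hd, h⟩ := hhom fun x y => g 1 (e x) (e y) ≤ g 0 (e x) (e y)
    have hinj' := hinj.comp_strictMono hd
    rcases h with h | h
    · refine hg 0 _ (he.comp hd) fun x y x' y' hxy hxy' heq => hinj' hxy hxy' ?_
      have h1 := max_eq_left (h x y hxy)
      have h2 := max_eq_left (h x' y' hxy')
      exact h1.trans (heq.trans h2.symm)
    · refine hg 1 _ (he.comp hd) fun x y x' y' hxy hxy' heq => hinj' hxy hxy' ?_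
      have h1 := max_eq_right (not_le.1 (h x y hxy)).le
      have h2 := max_eq_right (not_le.1 (h x' y' hxy')).le
      exact h1.trans (heq.trans h2.symm)
  · simp [max_eq_left (hz' _)]
  · simp [max_eq_right (hz' _)]

theorem NowhereInjAbove.comp_strictMono {X : Type u} [LinearOrder X] {g : X → X → X}
    (hg : NowhereInjAbove g) {e : X → X} (he : StrictMono e) :
    NowhereInjAbove fun x y => g (e x) (e y) :=
  fun _ hd => hg _ (he.comp hd)

/-- A finite family of nowhere injective functions becomes essentially unary simultaneously. -/
theorem exists_simultaneously_unary {X : Type u} [LinearOrder X] [WellFoundedLT X] [Infinite X]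
    (hsmall : ∀ x : X, #{y : X | y < x} < #X) (hreg : SmallBounded X) (hhom : Homogenizes X)
    {ι : Type*} (s : Finset ι) (g : ι → X → X → X) (hg : ∀ i, NowhereInjAbove (g i)) :
    ∃ e : X → X, StrictMono e ∧ ∀ i ∈ s, ∃ h : X → X,
      (∀ x y, x < y → g i (e x) (e y) = h x) ∨ (∀ x y, x < y → g i (e x) (e y) = h y) := by
  classical
  induction s using Finset.induction_on with
  | empty => exact ⟨id, strictMono_id, by simp⟩
  | insert a s _ ih =>
    obtain ⟨e, he, hs⟩ := ih
    obtain ⟨d, hd, hcase⟩ := exists_canonical hsmall hreg hhom fun x y => g a (e x) (e y)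
    refine ⟨e ∘ d, he.comp hd, fun i hi => ?_⟩
    rcases Finset.mem_insert.1 hi with rfl | hi
    · rcases hcase with ⟨h, hh⟩ | ⟨h, hh⟩ | hh
      · exact ⟨h, Or.inl hh⟩
      · exact ⟨h, Or.inr hh⟩
      · exact absurd hh ((hg i).comp_strictMono he d hd)
    · obtain ⟨h, hh⟩ := hs i hi
      exact ⟨h ∘ d, hh.imp (fun hh x y hxy => hh _ _ (hd hxy))
        fun hh x y hxy => hh _ _ (hd hxy)⟩

theorem IsClone.subset_nowhereInjClone {X : Type u} [LinearOrder X] [WellFoundedLT X]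
    [Infinite X] (hsmall : ∀ x : X, #{y : X | y < x} < #X) (hreg : SmallBounded X)
    (hhom : Homogenizes X) {C : Set (Operation X)} (hC : IsClone C)
    (hun : ∀ f : X → X, unaryOp f ∈ C) (hH : HeavilyBinary C) (hne : C ≠ Set.univ) :
    C ⊆ nowhereInjClone X := by
  rintro ⟨n, f⟩ hf g hg e he hinj
  obtain ⟨d, hd, hunary⟩ := exists_simultaneously_unary hsmall hreg hhom Finset.univ
    (fun i x y => g i (e x) (e y)) fun i => (hg i).comp_strictMono he
  have hinj' := hinj.comp_strictMono hd
  have hrep : ∀ i, ∃ k : X → X → X, binOp k ∈ C ∧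
      ∀ x y, x < y → g i (e (d x)) (e (d y)) = k x y := by
    intro i
    obtain ⟨h, hh | hh⟩ := hunary i (Finset.mem_univ i)
    · exact ⟨fun x _ => h x, hC.unary_comp_s16 hun (hC.1 1 0) h, hh⟩
    · exact ⟨fun _ y => h y, hC.unary_comp_s16 hun (hC.1 1 1) h, hh⟩
  choose k hkC hk using hrep
  have hF : binOp (fun x y => f fun i => k i x y) ∈ C :=
    hC.2 1 n f (fun i x => k i (x 0) (x 1)) hf hkC
  refine hne (hC.eq_univ_of_injAbove hsmall hreg hhom hun hH hF ?_)
  intro x y x' y' hxy hxy' heq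
  refine hinj' hxy hxy' ?_
  simpa only [hk _ _ _ hxy, hk _ _ _ hxy'] using heq

theorem stmt16 {X : Type u} [LinearOrder X] [WellFoundedLT X] [Infinite X]
    (hsmall : ∀ x : X, #{y : X | y < x} < #X)
    (hpart : ∀ f : X → X → Bool, ∃ A : Set X, #↥A = #X ∧ ∃ b : Bool,
      ∀ x ∈ A, ∀ y ∈ A, x < y → f x y = b) :
    (∃! C : Set (Operation X),
      PrecompleteClone C ∧ (∀ f : X → X, unaryOp f ∈ C) ∧ HeavilyBinary C) ∧
    (∀ C₁ C₂ : Set (Operation X), IsClone C₁ → IsClone C₂ →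
      (∀ f : X → X, unaryOp f ∈ C₁) → (∀ f : X → X, unaryOp f ∈ C₂) →
      HeavilyBinary C₁ → HeavilyBinary C₂ →
      cloneGen (C₁ ∪ C₂) = Set.univ → C₁ = Set.univ ∨ C₂ = Set.univ) := by
  have hreg := smallBounded_of_partition hsmall hpart
  have hhom := homogenizes_of_partition hsmall hreg hpart
  have := hreg.noMaxOrder
  have hKC := isClone_nowhereInjClone X
  have hKne := nowhereInjClone_ne_univ (X := X)
  have hKH := heavilyBinary_nowhereInjClone hhom
  have hsub : ∀ C : Set (Operation X), IsClone C → (∀ f : X → X, unaryOp f ∈ C) →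
      HeavilyBinary C → C ≠ Set.univ → C ⊆ nowhereInjClone X := fun C hC hun hH hne =>
    hC.subset_nowhereInjClone hsmall hreg hhom hun hH hne
  refine ⟨⟨nowhereInjClone X, ⟨⟨hKC, hKne, fun D hD hKD => ?_⟩,
    unaryOp_mem_nowhereInjClone, hKH⟩, ?_⟩, ?_⟩
  · by_cases hDu : D = Set.univ
    · exact Or.inr hDu
    · obtain ⟨H, hH, hH'⟩ := hKH
      exact Or.inl ((hsub D hD (fun f => hKD (unaryOp_mem_nowhereInjClone f))
        ⟨H, hKD hH, hH'⟩ hDu).antisymm hKD)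
  · rintro C ⟨⟨hC, hne, hmax⟩, hun, hH⟩
    rcases hmax _ hKC (hsub C hC hun hH hne) with h | h
    · exact h.symm
    · exact absurd h hKne
  · intro C₁ C₂ h₁ h₂ hu₁ hu₂ hH₁ hH₂ hgen
    by_contra! hcon
    refine hKne (Set.eq_univ_of_univ_subset (hgen ▸ Set.sInter_subset_of_mem ⟨hKC, ?_⟩))
    exact Set.union_subset (hsub C₁ h₁ hu₁ hH₁ hcon.1) (hsub C₂ h₂ hu₂ hH₂ hcon.2)
end
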